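/- Let T_n denote the number of spanning trees of the 2×n grid graph G_2(n). Then in the ring of formal power series over ℤ, (1 − 4x + x²) · Σ_{n ≥ 1} T_n xⁿ = x; that is, the ordinary generating function of the sequence (T_n)_{n≥1} is x/(1 − 4x + x²). -/

import Mathlib

open SimpleGraph

/-- The number of spanning trees of a simple graph `G`. -/
noncomputable def spanningTreeCount {V : Type*} (G : SimpleGraph V) : ℕ :=
  Nat.card {H : G.Subgraph // H.IsSpanning ∧ H.coe.IsTree}

/-- The number of spanning trees of the `k × n` grid graph `G_k(n) = P_k □ P_n`. -/
noncomputable def gridTreeCount (k n : ℕ) : ℕ :=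
  spanningTreeCount (pathGraph k □ pathGraph n)

namespace SimpleGraph

variable {V W : Type*}

theorem connected_iff_forall_iff {G : SimpleGraph V} :
    G.Connected ↔ Nonempty V ∧
      ∀ f : V → Prop, (∀ x y, G.Adj x y → (f x ↔ f y)) → ∀ x y, f x ↔ f y := by
  constructor
  · refine fun h => ⟨h.nonempty, fun f hf x y => ?_⟩
    obtain ⟨p⟩ := h.preconnected x y
    induction p with
    | nil => rfl
    | cons hadj _ ih => exact (hf _ _ hadj).trans ih
  · rintro ⟨hne, h⟩
    refine ⟨fun x y => ?_⟩
    refine (h (G.Reachable x) (fun u v huv => ?_) x y).1 (Reachable.refl x)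
    exact ⟨fun hu => hu.trans huv.reachable, fun hv => hv.trans huv.symm.reachable⟩

open Classical in
/-- The number of darts of `G`, as the sum of the entries of its adjacency matrix. -/
noncomputable def adjSum [Fintype V] (G : SimpleGraph V) : ℕ :=
  ∑ x, ∑ y, if G.Adj x y then 1 else 0

theorem adjSum_eq [Fintype V] (G : SimpleGraph V) : G.adjSum = 2 * Nat.card G.edgeSet := by
  classical
  rw [adjSum, Nat.card_eq_fintype_card, ← edgeFinset_card, ← sum_degrees_eq_twice_card_edges]
  exact Finset.sum_congr rfl fun x _ => (degree_eq_sum_if_adj (R := ℕ) G x).symm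

theorem isTree_iff_connected_and_adjSum [Fintype V] {G : SimpleGraph V} :
    G.IsTree ↔ G.Connected ∧ G.adjSum + 2 = 2 * Fintype.card V := by
  rw [isTree_iff_connected_and_card, adjSum_eq, Nat.card_eq_fintype_card (α := V)]
  exact and_congr_right fun _ => by omega

theorem Connected.two_mul_card_le_adjSum [Fintype V] {G : SimpleGraph V} (h : G.Connected) :
    2 * Fintype.card V ≤ G.adjSum + 2 := by
  have := h.card_vert_le_card_edgeSet_add_one
  rw [Nat.card_eq_fintype_card (α := V)] at this
  rw [adjSum_eq]
  omega

theorem adjSum_sup_edge [Fintype V] {G : SimpleGraph V} {u v : V} (huv : u ≠ v)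
    (h : ¬ G.Adj u v) : (G ⊔ edge u v).adjSum = G.adjSum + 2 := by
  classical
  rw [adjSum_eq, adjSum_eq, Nat.card_eq_fintype_card, Nat.card_eq_fintype_card,
    ← edgeFinset_card, ← edgeFinset_card, card_edgeFinset_sup_edge G h huv]
  ring

/-- Attach to `G` two new vertices `inr 0`, `inr 1`, where `inr i` is joined to `c i`
if `a i` holds, and the new vertices are joined to each other if `r` holds. -/
def attachPair (G : SimpleGraph V) (c : Fin 2 → V) (a : Fin 2 → Bool) (r : Bool) :
    SimpleGraph (V ⊕ Fin 2) where
  Adj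
    | .inl x, .inl y => G.Adj x y
    | .inl x, .inr i => a i ∧ x = c i
    | .inr i, .inl x => a i ∧ x = c i
    | .inr i, .inr j => r ∧ i ≠ j
  symm := ⟨by
    rintro (x | i) (y | j) h
    · exact Adj.symm (G := G) h
    · exact h
    · exact h
    · exact ⟨h.1, h.2.symm⟩⟩
  loopless := ⟨by
    rintro (x | i) h
    · exact G.irrefl h
    · exact h.2 rfl⟩

section attachPair

variable (G : SimpleGraph V) (c : Fin 2 → V) (a : Fin 2 → Bool) (r : Bool)

@[simp] theorem attachPair_adj_inl_inl (x y : V) :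
    (G.attachPair c a r).Adj (.inl x) (.inl y) ↔ G.Adj x y := Iff.rfl

@[simp] theorem attachPair_adj_inl_inr (x : V) (i : Fin 2) :
    (G.attachPair c a r).Adj (.inl x) (.inr i) ↔ a i ∧ x = c i := Iff.rfl

@[simp] theorem attachPair_adj_inr_inl (x : V) (i : Fin 2) :
    (G.attachPair c a r).Adj (.inr i) (.inl x) ↔ a i ∧ x = c i := Iff.rfl

@[simp] theorem attachPair_adj_inr_inr (i j : Fin 2) :
    (G.attachPair c a r).Adj (.inr i) (.inr j) ↔ r ∧ i ≠ j := Iff.rfl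

theorem adjSum_attachPair [Fintype V] : (G.attachPair c a r).adjSum =
    G.adjSum + 2 * ((a 0).toNat + (a 1).toNat + r.toNat) := by
  classical
  simp only [adjSum, Fintype.sum_sum_type, attachPair_adj_inl_inl, attachPair_adj_inl_inr,
    attachPair_adj_inr_inl, attachPair_adj_inr_inr, Fin.sum_univ_two, Finset.sum_add_distrib]
  cases a 0 <;> cases a 1 <;> cases r <;> simp

theorem attachPair_connected_iff : (G.attachPair c a r).Connected ↔
    ∀ (f : V → Prop) (g : Fin 2 → Prop), (∀ x y, G.Adj x y → (f x ↔ f y)) →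
      (∀ i, a i → (g i ↔ f (c i))) → (r → (g 0 ↔ g 1)) →
      (∀ x y, f x ↔ f y) ∧ ∀ x i, f x ↔ g i := by
  rw [connected_iff_forall_iff]
  constructor
  · rintro ⟨-, h⟩ f g hf ha hr
    have := h (Sum.elim f g) (by
      rintro (x | i) (y | j) hadj
      · exact hf _ _ hadj
      · obtain ⟨h1, rfl⟩ := hadj
        exact (ha _ h1).symm
      · obtain ⟨h1, rfl⟩ := hadj
        exact ha _ h1
      · obtain ⟨h1, h2⟩ := hadj
        have := hr h1
        fin_cases i <;> fin_cases j
        · exact absurd rfl h2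
        · exact this
        · exact this.symm
        · exact absurd rfl h2)
    exact ⟨fun x y => this (.inl x) (.inl y), fun x i => this (.inl x) (.inr i)⟩
  · refine fun h => ⟨⟨.inr 0⟩, fun f hf => ?_⟩
    obtain ⟨h1, h2⟩ := h (f ∘ Sum.inl) (f ∘ Sum.inr) (fun x y hxy => hf _ _ hxy)
      (fun i hi => hf _ _ ⟨hi, rfl⟩) (fun hr => hf _ _ ⟨hr, by decide⟩)
    rintro (x | i) (y | j)
    · exact h1 x y
    · exact h2 x j
    · exact (h2 y i).symm
    · exact (h2 (c 0) i).symm.trans (h2 (c 0) j)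

end attachPair

/-- `H` is a spanning forest with two components, one containing `c 0` and the other `c 1`:
joining `c 0` to `c 1` by a new edge gives a tree. -/
def IsSplitForest (H : SimpleGraph V) (c : Fin 2 → V) : Prop :=
  ¬ H.Adj (c 0) (c 1) ∧ (H ⊔ edge (c 0) (c 1)).IsTree

theorem attachPair_connected_iff_of_two {G : SimpleGraph V} {c : Fin 2 → V} {a : Fin 2 → Bool}
    {r : Bool} (h : (a 0).toNat + (a 1).toNat + r.toNat = 2) :
    (G.attachPair c a r).Connected ↔ G.Connected := by
  have : Nonempty V := ⟨c 0⟩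
  rw [attachPair_connected_iff, connected_iff_forall_iff]
  simp only [this, true_and, Fin.forall_fin_two]
  constructor
  · intro H f hf
    rcases h0 : a 0 <;> rcases h1 : a 1 <;> rcases hr : r <;> simp [h0, h1, hr] at h H
    · exact (H f (fun _ => f (c 1)) hf Iff.rfl Iff.rfl).1
    · exact (H f (fun _ => f (c 0)) hf Iff.rfl Iff.rfl).1
    · exact (H f (fun i => f (c i)) hf Iff.rfl Iff.rfl).1
  · intro H f g hf ha hr'
    have := H f hf
    refine ⟨this, fun x => ?_⟩
    have e0 := this x (c 0)
    have e1 := this x (c 1)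
    clear H this
    rcases h0 : a 0 <;> rcases h1 : a 1 <;> rcases hr : r <;> simp [h0, h1, hr] at h ha hr'
    all_goals tauto

theorem not_attachPair_connected_of_lt_two {G : SimpleGraph V} {c : Fin 2 → V} {a : Fin 2 → Bool}
    {r : Bool} (h : (a 0).toNat + (a 1).toNat + r.toNat < 2) :
    ¬ (G.attachPair c a r).Connected := by
  rw [attachPair_connected_iff]
  intro H
  have := H (fun _ => True) (fun i => a i) (by simp) (by simp)
  have h' := H (fun _ => True) (fun _ => False) (by simp)
  simp only [Fin.forall_fin_two] at this h'
  rcases h0 : a 0 <;> rcases h1 : a 1 <;> rcases hr : r <;> simp_all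
  all_goals exact this (c 0)

theorem attachPair_connected_iff_of_three {G : SimpleGraph V} {c : Fin 2 → V} {a : Fin 2 → Bool}
    {r : Bool} (hc : c 0 ≠ c 1) (h : (a 0).toNat + (a 1).toNat + r.toNat = 3) :
    (G.attachPair c a r).Connected ↔ (G ⊔ edge (c 0) (c 1)).Connected := by
  have : Nonempty V := ⟨c 0⟩
  obtain ⟨h0, h1, rfl⟩ : a 0 = true ∧ a 1 = true ∧ r = true := by
    rcases h0 : a 0 <;> rcases h1 : a 1 <;> rcases hr : r <;> simp_all
  rw [attachPair_connected_iff, connected_iff_forall_iff]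
  simp only [this, true_and, Fin.forall_fin_two, h0, h1, forall_const, sup_adj, edge_adj]
  constructor
  · intro H f hf
    exact (H f (fun i => f (c i)) (fun x y hxy => hf x y (.inl hxy)) (by simp)
      (hf _ _ (.inr ⟨.inl ⟨rfl, rfl⟩, hc⟩))).1
  · intro H f g hf ha hr
    have := H f (by
      rintro x y (hxy | ⟨⟨rfl, rfl⟩ | ⟨rfl, rfl⟩, -⟩)
      · exact hf x y hxy
      · rw [← ha.1, ← ha.2, hr]
      · rw [← ha.1, ← ha.2, hr])
    exact ⟨this, fun x => ⟨(this x (c 0)).trans ha.1.symm, (this x (c 1)).trans ha.2.symm⟩⟩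

section IsTree

variable {G : SimpleGraph V} {c : Fin 2 → V} {a : Fin 2 → Bool} {r : Bool}

theorem not_attachPair_isTree_of_lt_two (h : (a 0).toNat + (a 1).toNat + r.toNat < 2) :
    ¬ (G.attachPair c a r).IsTree :=
  fun ht => not_attachPair_connected_of_lt_two h ht.connected

theorem attachPair_isSplitForest_iff :
    (G.attachPair c a r).IsSplitForest Sum.inr ↔
      r = false ∧ (G.attachPair c a true).IsTree := by
  have key : G.attachPair c a false ⊔ edge (.inr 0) (.inr 1) = G.attachPair c a true := by
    ext (x | i) (y | j)
    · simp [edge_adj]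
    · simp [edge_adj]
    · simp [edge_adj]
    · fin_cases i <;> fin_cases j <;> simp [edge_adj]
  rcases r
  · simp [IsSplitForest, key]
  · simp [IsSplitForest]

variable [Fintype V]

theorem attachPair_isTree_iff_of_two (h : (a 0).toNat + (a 1).toNat + r.toNat = 2) :
    (G.attachPair c a r).IsTree ↔ G.IsTree := by
  rw [isTree_iff_connected_and_adjSum, isTree_iff_connected_and_adjSum,
    attachPair_connected_iff_of_two h, adjSum_attachPair, h]
  simp only [Fintype.card_sum, Fintype.card_fin]
  exact and_congr_right fun _ => by omega

theorem attachPair_isTree_iff_of_three (hc : c 0 ≠ c 1)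
    (h : (a 0).toNat + (a 1).toNat + r.toNat = 3) :
    (G.attachPair c a r).IsTree ↔ G.IsSplitForest c := by
  rw [IsSplitForest, isTree_iff_connected_and_adjSum, isTree_iff_connected_and_adjSum,
    attachPair_connected_iff_of_three hc h, adjSum_attachPair, h]
  simp only [Fintype.card_sum, Fintype.card_fin]
  by_cases hadj : G.Adj (c 0) (c 1)
  · rw [sup_edge_of_adj G hadj]
    simp only [hadj, not_true_eq_false, false_and, iff_false, not_and]
    intro hcon
    have := hcon.two_mul_card_le_adjSum
    omega
  · rw [adjSum_sup_edge hc hadj]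
    simp only [hadj, not_false_eq_true, true_and]
    exact and_congr_right fun _ => by omega

end IsTree

/-- The number of spanning forests of `G` with two components that separate `c 0` from `c 1`. -/
noncomputable def splitForestCount (G : SimpleGraph V) (c : Fin 2 → V) : ℕ :=
  Nat.card {H : SimpleGraph V // H ≤ G ∧ H.IsSplitForest c}

theorem spanningTreeCount_eq (G : SimpleGraph V) :
    spanningTreeCount G = Nat.card {H : SimpleGraph V // H ≤ G ∧ H.IsTree} := by
  refine Nat.card_congr
    { toFun := fun H => ⟨H.1.spanningCoe, H.1.spanningCoe_le,
        (H.1.spanningCoeEquivCoeOfSpanning H.2.1).isTree_iff.2 H.2.2⟩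
      invFun := fun H => ⟨toSubgraph H.1 H.2.1, toSubgraph.isSpanning H.1 H.2.1,
        ((toSubgraph H.1 H.2.1).spanningCoeEquivCoeOfSpanning
          (toSubgraph.isSpanning H.1 H.2.1)).isTree_iff.1 H.2.2⟩
      left_inv := ?_
      right_inv := fun H => rfl }
  rintro ⟨H, hs, ht⟩
  ext x y
  · simpa using hs x
  · simp

theorem attachPair_mono {G H : SimpleGraph V} (h : H ≤ G) (c : Fin 2 → V) (a b r : Bool) :
    H.attachPair c ![a, b] r ≤ G.attachPair c ![true, true] true := by
  rintro (x | i) (y | j)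
  · exact fun hadj => h hadj
  · exact fun hadj => ⟨by fin_cases j <;> rfl, hadj.2⟩
  · exact fun hadj => ⟨by fin_cases i <;> rfl, hadj.2⟩
  · exact fun hadj => ⟨rfl, hadj.2⟩

theorem attachPair_injective {H H' : SimpleGraph V} {c : Fin 2 → V} {a b r a' b' r' : Bool}
    (h : H.attachPair c ![a, b] r = H'.attachPair c ![a', b'] r') :
    ((a, b, r), H) = ((a', b', r'), H') := by
  have adj x y := iff_of_eq (congrArg (fun K : SimpleGraph (V ⊕ Fin 2) => K.Adj x y) h)
  obtain rfl : a = a' := Bool.eq_iff_iff.2 (by simpa using adj (.inl (c 0)) (.inr 0))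
  obtain rfl : b = b' := Bool.eq_iff_iff.2 (by simpa using adj (.inl (c 1)) (.inr 1))
  obtain rfl : r = r' := Bool.eq_iff_iff.2 (by simpa using adj (.inr 0) (.inr 1))
  obtain rfl : H = H' := by
    ext x y
    simpa using adj (.inl x) (.inl y)
  rfl

open Classical in
theorem attachPair_comap_inl {G : SimpleGraph V} {c : Fin 2 → V} {K : SimpleGraph (V ⊕ Fin 2)}
    (hK : K ≤ G.attachPair c ![true, true] true) :
    (K.comap Sum.inl).attachPair c ![decide (K.Adj (.inl (c 0)) (.inr 0)),
      decide (K.Adj (.inl (c 1)) (.inr 1))] (decide (K.Adj (.inr 0) (.inr 1))) = K := by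
  have hnew (x : V) (i : Fin 2) : K.Adj (.inl (c i)) (.inr i) ∧ x = c i ↔
      K.Adj (.inl x) (.inr i) :=
    ⟨fun h => h.2 ▸ h.1, fun h => by obtain rfl := (hK h).2; exact ⟨h, rfl⟩⟩
  ext (x | i) (y | j)
  · simp
  · fin_cases j
    · simpa using hnew x 0
    · simpa using hnew x 1
  · rw [adj_comm, K.adj_comm (.inr i) (.inl y)]
    fin_cases i
    · simpa using hnew y 0
    · simpa using hnew y 1
  · fin_cases i <;> fin_cases j <;> simp [K.adj_comm]

theorem card_attachPair_subgraph [Finite V] (G : SimpleGraph V) (c : Fin 2 → V)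
    (P : SimpleGraph (V ⊕ Fin 2) → Prop) :
    Nat.card {H : SimpleGraph (V ⊕ Fin 2) // H ≤ G.attachPair c ![true, true] true ∧ P H} =
      ∑ s : Bool × Bool × Bool,
        Nat.card {H : SimpleGraph V // H ≤ G ∧ P (H.attachPair c ![s.1, s.2.1] s.2.2)} := by
  classical
  rw [← Nat.card_sigma]
  refine (Nat.card_congr (Equiv.ofBijective
    (fun H => ⟨H.2.1.attachPair c ![H.1.1, H.1.2.1] H.1.2.2,
      attachPair_mono H.2.2.1 c _ _ _, H.2.2.2⟩) ⟨?_, ?_⟩)).symm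
  · rintro ⟨⟨a, b, r⟩, H, hH⟩ ⟨⟨a', b', r'⟩, H', hH'⟩ h
    cases attachPair_injective (congrArg Subtype.val h)
    rfl
  · rintro ⟨K, hK, hP⟩
    have key := attachPair_comap_inl hK
    refine ⟨⟨(_, _, _), K.comap Sum.inl, fun x y h => hK h, ?_⟩, Subtype.ext key⟩
    exact key.symm ▸ hP

theorem spanningTreeCount_attachPair [Finite V] (G : SimpleGraph V) {c : Fin 2 → V}
    (hc : c 0 ≠ c 1) : spanningTreeCount (G.attachPair c ![true, true] true) =
      3 * spanningTreeCount G + splitForestCount G c := by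
  have := Fintype.ofFinite V
  simp only [spanningTreeCount_eq, splitForestCount, card_attachPair_subgraph,
    Fintype.sum_prod_type, Fintype.sum_bool]
  have h1 (H : SimpleGraph V) := @attachPair_isTree_iff_of_three _ H c ![true, true] true _ hc rfl
  simp [h1, attachPair_isTree_iff_of_two, not_attachPair_isTree_of_lt_two]
  ring

theorem splitForestCount_attachPair [Finite V] (G : SimpleGraph V) {c : Fin 2 → V}
    (hc : c 0 ≠ c 1) : splitForestCount (G.attachPair c ![true, true] true) Sum.inr =
      2 * spanningTreeCount G + splitForestCount G c := by
  have := Fintype.ofFinite V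
  simp only [spanningTreeCount_eq, splitForestCount, card_attachPair_subgraph,
    Fintype.sum_prod_type, Fintype.sum_bool, attachPair_isSplitForest_iff]
  have h1 (H : SimpleGraph V) := @attachPair_isTree_iff_of_three _ H c ![true, true] true _ hc rfl
  simp [h1, attachPair_isTree_iff_of_two, not_attachPair_isTree_of_lt_two]
  ring

theorem Iso.le_iff_comap_symm_le {G : SimpleGraph V} {G' : SimpleGraph W} (e : G ≃g G')
    (H : SimpleGraph V) : H ≤ G ↔ H.comap e.symm ≤ G' := by
  constructor
  · intro h x y hxy
    exact e.symm.map_adj_iff.1 (h hxy)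
  · intro h x y hxy
    exact e.map_adj_iff.1 (h (by simpa using hxy))

theorem Iso.spanningTreeCount_eq {G : SimpleGraph V} {G' : SimpleGraph W} (e : G ≃g G') :
    spanningTreeCount G = spanningTreeCount G' := by
  rw [SimpleGraph.spanningTreeCount_eq, SimpleGraph.spanningTreeCount_eq]
  exact Nat.card_congr (e.toEquiv.simpleGraph.subtypeEquiv fun H =>
    and_congr (e.le_iff_comap_symm_le H) (Iso.comap e.toEquiv.symm H).isTree_iff.symm)

theorem Iso.splitForestCount_eq {G : SimpleGraph V} {G' : SimpleGraph W} (e : G ≃g G')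
    (c : Fin 2 → V) : splitForestCount G c = splitForestCount G' (e ∘ c) := by
  refine Nat.card_congr (e.toEquiv.simpleGraph.subtypeEquiv fun H =>
    and_congr (e.le_iff_comap_symm_le H) (and_congr ?_ ?_))
  · change _ ↔ ¬ H.Adj (e.symm (e (c 0))) (e.symm (e (c 1)))
    rw [e.symm_apply_apply, e.symm_apply_apply]
  · rw [← (Iso.comap e.toEquiv.symm _).isTree_iff]
    refine iff_of_eq (congrArg _ ?_)
    ext x y
    simp [Equiv.simpleGraph, edge_adj, Equiv.symm_apply_eq]

/-- Attaching a new last column to a `2 × (n + 1)` grid. -/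
def attachPairLadderIso (n : ℕ) :
    (pathGraph 2 □ pathGraph (n + 1)).attachPair (fun i => (i, Fin.last n)) ![true, true] true ≃g
      pathGraph 2 □ pathGraph (n + 2) where
  toFun := Sum.elim (fun p => (p.1, p.2.castSucc)) (fun i => (i, Fin.last (n + 1)))
  invFun p := Fin.lastCases (.inr p.1) (fun j => .inl (p.1, j)) p.2
  left_inv := by rintro (⟨i, j⟩ | i) <;> simp
  right_inv := by
    rintro ⟨i, j⟩
    induction j using Fin.lastCases <;> simp
  map_rel_iff' := by
    rintro (⟨i, j⟩ | i) (⟨k, l⟩ | k)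
    · simp [boxProd_adj, pathGraph_adj]
    · simp [boxProd_adj, pathGraph_adj, Fin.ext_iff, j.isLt.ne]
      fin_cases k <;> simp <;> omega
    · simp [boxProd_adj, pathGraph_adj, Fin.ext_iff, l.isLt.ne']
      fin_cases i <;> simp <;> omega
    · simp [boxProd_adj, pathGraph_adj]
      omega

theorem ladder_one_isTree : (pathGraph 2 □ pathGraph 1).IsTree := by
  rw [isTree_iff_connected_and_adjSum]
  refine ⟨(pathGraph_connected 1).boxProd (pathGraph_connected 0), ?_⟩
  simp [adjSum, Fintype.sum_prod_type, pathGraph_adj, Fin.sum_univ_two, -Finset.sum_boole]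

theorem ladder_one_eq_edge :
    (pathGraph 2 □ pathGraph 1) = edge ((0 : Fin 2), Fin.last 0) ((1 : Fin 2), Fin.last 0) := by
  ext ⟨i, j⟩ ⟨k, l⟩
  fin_cases i <;> fin_cases j <;> fin_cases k <;> fin_cases l <;>
    simp [edge_adj, pathGraph_adj]

theorem spanningTreeCount_ladder_one : spanningTreeCount (pathGraph 2 □ pathGraph 1) = 1 := by
  rw [spanningTreeCount_eq, Nat.card_eq_one_iff_exists]
  refine ⟨⟨_, le_rfl, ladder_one_isTree⟩, fun ⟨H, hle, hH⟩ => Subtype.ext ?_⟩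
  exact (isTree_iff_minimal_connected.1 ladder_one_isTree).eq_of_ge hH.connected hle |>.symm

theorem splitForestCount_ladder_one :
    splitForestCount (pathGraph 2 □ pathGraph 1) (fun i => (i, Fin.last 0)) = 1 := by
  rw [splitForestCount, Nat.card_eq_one_iff_exists]
  refine ⟨⟨⊥, bot_le, not_false, ?_⟩, fun ⟨H, hle, hH, _⟩ => Subtype.ext ?_⟩
  · rw [bot_sup_eq, ← ladder_one_eq_edge]
    exact ladder_one_isTree
  · rw [ladder_one_eq_edge] at hle
    refine eq_bot_iff.2 fun x y hxy => ?_
    obtain ⟨⟨rfl, rfl⟩ | ⟨rfl, rfl⟩, -⟩ := (edge_adj ..).1 (hle hxy)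
    · exact hH hxy
    · exact hH hxy.symm

/-- The number of two-component spanning forests of the `2 × (n + 1)` grid that separate the two
vertices of the last column. -/
noncomputable def ladderSplitForestCount (n : ℕ) : ℕ :=
  splitForestCount (pathGraph 2 □ pathGraph (n + 1)) (fun i => (i, Fin.last n))

theorem gridTreeCount_two_succ (n : ℕ) :
    gridTreeCount 2 (n + 2) = 3 * gridTreeCount 2 (n + 1) + ladderSplitForestCount n := by
  rw [gridTreeCount, ← (attachPairLadderIso n).spanningTreeCount_eq,
    spanningTreeCount_attachPair _ (by simp)]
  rfl

theorem ladderSplitForestCount_succ (n : ℕ) :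
    ladderSplitForestCount (n + 1) = 2 * gridTreeCount 2 (n + 1) + ladderSplitForestCount n := by
  have := (attachPairLadderIso n).splitForestCount_eq Sum.inr
  rw [splitForestCount_attachPair _ (by simp)] at this
  exact this.symm

theorem gridTreeCount_two_recurrence (n : ℕ) :
    gridTreeCount 2 (n + 3) + gridTreeCount 2 (n + 1) = 4 * gridTreeCount 2 (n + 2) := by
  have h1 := gridTreeCount_two_succ n
  have h2 : gridTreeCount 2 (n + 3) = _ := gridTreeCount_two_succ (n + 1)
  have h3 := ladderSplitForestCount_succ n
  rw [show n + 1 + 1 = n + 2 from rfl] at h2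
  omega

end SimpleGraph

/-- The ordinary generating function of the numbers of spanning trees of the `2 × n` grid
graphs is `x / (1 - 4x + x²)`: in `ℤ⟦x⟧`, `(1 - 4x + x²) · ∑_{n ≥ 1} T_n xⁿ = x`. -/
theorem gridTreeCount_two_generatingFunction :
    (1 - 4 * PowerSeries.X + PowerSeries.X ^ 2) *
        PowerSeries.mk (fun n => if n = 0 then 0 else (gridTreeCount 2 n : ℤ)) =
      (PowerSeries.X : PowerSeries ℤ) := by
  have h1 : gridTreeCount 2 1 = 1 := spanningTreeCount_ladder_one
  have h2 : gridTreeCount 2 2 = 4 := by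
    rw [gridTreeCount_two_succ 0, h1, ladderSplitForestCount, splitForestCount_ladder_one]
  have h4 : (4 : PowerSeries ℤ) = PowerSeries.C 4 := (map_ofNat _ 4).symm
  rw [add_mul, sub_mul, one_mul, mul_assoc, h4, ← PowerSeries.smul_eq_C_mul]
  ext n
  match n with
  | 0 => simp
  | 1 => simp [PowerSeries.coeff_X_pow_mul', PowerSeries.coeff_succ_X_mul, h1]
  | 2 =>
    simp [PowerSeries.coeff_X_pow_mul', PowerSeries.coeff_succ_X_mul, PowerSeries.coeff_X, h1, h2]
  | n + 3 =>
    have := gridTreeCount_two_recurrence n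
    simp [PowerSeries.coeff_X_pow_mul', PowerSeries.coeff_succ_X_mul, PowerSeries.coeff_X]
    omega
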